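/- arXiv:2210.13458 — 12 statements merged into one kernel-verified Lean document; each statement's English description precedes it below -/
import Mathlib

section
/- In the confusion-matrix OSR setting, suppose the number of close-set samples predicted into a wrong known class, i.e. the cardinality of {s ∈ S : y s ≠ C+1 ∧ p s ≠ C+1 ∧ p s ≠ y s}, is at least TP_{C+1}(p). Then there exists a prediction map p̃ : S → {1,…,C+1} such that for every known class c ∈ {1,…,C} one has TP_c(p̃) = TP_c(p), FP_c(p̃) = FP_c(p), FN_c(p̃) = FN_c(p) and TN_c(p̃) = TN_c(p), while TP_{C+1}(p̃) = 0, i.e. p̃ classifies every open-set sample into a known class. In particular, any metric that depends only on the confusion-matrix entries of the known classes takes the same value on p̃ as on p (Inconsistency Property I). -/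
open Finset

/-- True positives of class `c`. -/
def TPc {S : Type*} [Fintype S] (y q : S → ℕ) (c : ℕ) : ℕ :=
  (Finset.univ.filter (fun s => y s = c ∧ q s = c)).card

/-- False positives of class `c`. -/
def FPc {S : Type*} [Fintype S] (y q : S → ℕ) (c : ℕ) : ℕ :=
  (Finset.univ.filter (fun s => y s ≠ c ∧ q s = c)).card

/-- False negatives of class `c`. -/
def FNc {S : Type*} [Fintype S] (y q : S → ℕ) (c : ℕ) : ℕ :=
  (Finset.univ.filter (fun s => y s = c ∧ q s ≠ c)).card

/-- True negatives of class `c`. -/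
def TNc {S : Type*} [Fintype S] (y q : S → ℕ) (c : ℕ) : ℕ :=
  (Finset.univ.filter (fun s => y s ≠ c ∧ q s ≠ c)).card

/-- An involution exchanging two disjoint finsets of the same size. -/
theorem exists_swap_perm {S : Type*} (A B : Finset S) (hd : Disjoint A B)
    (hc : A.card = B.card) :
    ∃ σ : Equiv.Perm S, (∀ s ∈ A, σ s ∈ B) ∧ (∀ s ∈ B, σ s ∈ A) ∧
      (∀ s, s ∉ A → s ∉ B → σ s = s) := by
  classical
  have e : A ≃ B := Finset.equivOfCardEq hc
  have hAB : ∀ s, s ∈ A → s ∉ B := fun s h => Finset.disjoint_left.mp hd h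
  let f : S → S := fun s => if h : s ∈ A then (e ⟨s, h⟩ : S) else
    if h' : s ∈ B then (e.symm ⟨s, h'⟩ : S) else s
  have fA : ∀ s (h : s ∈ A), f s = e ⟨s, h⟩ := fun s h => by simp [f, h]
  have fB : ∀ s (h : s ∈ B), f s = e.symm ⟨s, h⟩ := fun s h => by
    have : s ∉ A := fun h' => hAB s h' h
    simp [f, h, this]
  have fN : ∀ s, s ∉ A → s ∉ B → f s = s := fun s h h' => by simp [f, h, h']
  have hf : Function.Involutive f := by
    intro s
    by_cases h : s ∈ A
    · rw [fA s h, fB _ (e ⟨s, h⟩).2]; simp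
    · by_cases h' : s ∈ B
      · rw [fB s h', fA _ (e.symm ⟨s, h'⟩).2]; simp
      · rw [fN s h h', fN s h h']
  refine ⟨hf.toPerm, ?_, ?_, ?_⟩
  · intro s h
    change f s ∈ B
    rw [fA s h]; exact (e ⟨s, h⟩).2
  · intro s h
    change f s ∈ A
    rw [fB s h]; exact (e.symm ⟨s, h⟩).2
  · exact fN

theorem TPc_add_FPc {S : Type*} [Fintype S] (y q : S → ℕ) (c : ℕ) :
    TPc y q c + FPc y q c = (Finset.univ.filter (fun s => q s = c)).card := by
  rw [← Finset.card_filter_add_card_filter_not (s := Finset.univ.filter (fun s => q s = c))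
    (fun s => y s = c)]
  simp only [Finset.filter_filter, TPc, FPc, and_comm, ne_eq]

theorem FPc_add_TNc {S : Type*} [Fintype S] (y q : S → ℕ) (c : ℕ) :
    FPc y q c + TNc y q c = (Finset.univ.filter (fun s => y s ≠ c)).card := by
  rw [← Finset.card_filter_add_card_filter_not (s := Finset.univ.filter (fun s => y s ≠ c))
    (fun s => q s = c)]
  simp only [Finset.filter_filter, TNc, FPc, ne_eq]

/-- Inconsistency Property I: if the number of close-set samples predicted into a wrong
known class is at least `TP_{C+1}(p)`, then there exists a prediction map `pt` having
exactly the same confusion-matrix entries on every known class, yet classifying every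
open-set sample into a known class (`TP_{C+1}(pt) = 0`).  In particular any metric
depending only on the known-class confusion-matrix entries takes the same value on
`pt` as on `p`. -/
theorem inconsistency_property_I
    {S : Type*} [Fintype S] [Nonempty S] (C : ℕ) (hC : 1 ≤ C)
    (y p : S → ℕ)
    (hy : ∀ s, y s ∈ Finset.Icc 1 (C + 1))
    (hp : ∀ s, p s ∈ Finset.Icc 1 (C + 1))
    (hcond : TPc y p (C + 1) ≤
      (Finset.univ.filter (fun s => y s ≠ C + 1 ∧ p s ≠ C + 1 ∧ p s ≠ y s)).card) :
    ∃ pt : S → ℕ,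
      (∀ s, pt s ∈ Finset.Icc 1 (C + 1)) ∧
      (∀ c ∈ Finset.Icc 1 C,
        TPc y pt c = TPc y p c ∧ FPc y pt c = FPc y p c ∧
        FNc y pt c = FNc y p c ∧ TNc y pt c = TNc y p c) ∧
      TPc y pt (C + 1) = 0 ∧
      (∀ M : (ℕ → ℕ × ℕ × ℕ × ℕ) → ℝ,
        ∀ entries entries' : ℕ → ℕ × ℕ × ℕ × ℕ,
          (∀ c ∈ Finset.Icc 1 C, entries c = (TPc y p c, FPc y p c, FNc y p c, TNc y p c)) →
          (∀ c ∈ Finset.Icc 1 C, entries' c = (TPc y pt c, FPc y pt c, FNc y pt c, TNc y pt c)) →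
          (∀ e e' : ℕ → ℕ × ℕ × ℕ × ℕ, (∀ c ∈ Finset.Icc 1 C, e c = e' c) → M e = M e') →
          M entries' = M entries) := by
  classical
  obtain ⟨B, hB, hBc⟩ := Finset.exists_subset_card_eq hcond
  have hB' : ∀ s ∈ B, y s ≠ C + 1 ∧ p s ≠ C + 1 ∧ p s ≠ y s := fun s hs => by
    simpa using hB hs
  obtain ⟨σ, hσA, hσB, hσN⟩ := exists_swap_perm
    (Finset.univ.filter (fun s => y s = C + 1 ∧ p s = C + 1)) B
    (Finset.disjoint_left.mpr fun s hs hs' => (hB' s hs').1 (by simp at hs; exact hs.1))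
    hBc.symm
  simp only [Finset.mem_filter, Finset.mem_univ, true_and] at hσA hσB hσN
  have key : ∀ c ∈ Finset.Icc 1 C, ∀ s, y s = c → (p (σ s) = c ↔ p s = c) := by
    intro c hc s hs
    rw [Finset.mem_Icc] at hc
    by_cases h : s ∈ B
    · have h1 := hσB s h
      have h2 := hB' s h
      omega
    · rw [hσN s (by omega) h]
  have main : ∀ c ∈ Finset.Icc 1 C,
        TPc y (fun s => p (σ s)) c = TPc y p c ∧ FPc y (fun s => p (σ s)) c = FPc y p c ∧
        FNc y (fun s => p (σ s)) c = FNc y p c ∧ TNc y (fun s => p (σ s)) c = TNc y p c := by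
    intro c hc
    have hT : TPc y (fun s => p (σ s)) c = TPc y p c := by
      unfold TPc
      congr 1
      ext s
      simpa using key c hc s
    have hF : FNc y (fun s => p (σ s)) c = FNc y p c := by
      unfold FNc
      congr 1
      ext s
      simp only [Finset.mem_filter, Finset.mem_univ, true_and]
      exact and_congr_right fun h => not_congr (key c hc s h)
    have hcard : (Finset.univ.filter (fun s => p (σ s) = c)).card
        = (Finset.univ.filter (fun s => p s = c)).card :=
      Finset.card_equiv σ (by simp)
    have h1 := TPc_add_FPc y (fun s => p (σ s)) c
    have h2 := TPc_add_FPc y p c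
    have h3 := FPc_add_TNc y (fun s => p (σ s)) c
    have h4 := FPc_add_TNc y p c
    refine ⟨hT, ?_, hF, ?_⟩ <;> omega
  refine ⟨fun s => p (σ s), fun s => hp _, main, ?_, ?_⟩
  · unfold TPc
    rw [Finset.card_eq_zero, Finset.filter_eq_empty_iff]
    rintro s - ⟨h1, h2⟩
    beta_reduce at h2
    by_cases h : p s = C + 1
    · exact (hB' _ (hσA s ⟨h1, h⟩)).2.1 h2
    · have : s ∉ B := fun hs => (hB' s hs).1 h1
      rw [hσN s (by omega) this] at h2
      exact h h2
  · intro M e e' he he' hM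
    apply hM
    intro c hc
    obtain ⟨a, b, d, f⟩ := main c hc
    rw [he c hc, he' c hc, a, b, d, f]
end

section
/- In the confusion-matrix OSR setting, suppose the number of close-set samples predicted into a wrong known class, i.e. #{s ∈ S : y s ≠ C+1 ∧ p s ≠ C+1 ∧ p s ≠ y s}, is at least TP_{C+1}(p). Then there exists a prediction map p̃ : S → {1,…,C+1} such that the macro open-set F-score satisfies F(p̃) = F(p) while TP_{C+1}(p̃) = 0, i.e. p̃ classifies every open-set sample into a known class. -/
open Finset

/-- Macro precision over the known classes `1,…,C`. -/
noncomputable def PkMacro {S : Type*} [Fintype S] (y q : S → ℕ) (C : ℕ) : ℝ :=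
  (1 / (C : ℝ)) *
    ∑ c ∈ Finset.Icc 1 C, (TPc y q c : ℝ) / ((TPc y q c : ℝ) + (FPc y q c : ℝ))

/-- Macro recall (TPR) over the known classes `1,…,C`. -/
noncomputable def TPRkMacro {S : Type*} [Fintype S] (y q : S → ℕ) (C : ℕ) : ℝ :=
  (1 / (C : ℝ)) *
    ∑ c ∈ Finset.Icc 1 C, (TPc y q c : ℝ) / ((TPc y q c : ℝ) + (FNc y q c : ℝ))

/-- Macro open-set F-score. -/
noncomputable def FMacro {S : Type*} [Fintype S] (y q : S → ℕ) (C : ℕ) : ℝ :=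
  2 * (PkMacro y q C * TPRkMacro y q C) / (PkMacro y q C + TPRkMacro y q C)

theorem swap_step_aux {S : Type*} [Fintype S] (C : ℕ) (y : S → ℕ) (n : ℕ) :
    ∀ p : S → ℕ, (∀ s, p s ∈ Finset.Icc 1 (C + 1)) → TPc y p (C + 1) = n →
    n ≤ (Finset.univ.filter (fun s => y s ≠ C + 1 ∧ p s ≠ C + 1 ∧ p s ≠ y s)).card →
    ∃ pt : S → ℕ,
      (∀ s, pt s ∈ Finset.Icc 1 (C + 1)) ∧
      FMacro y pt C = FMacro y p C ∧
      TPc y pt (C + 1) = 0 := by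
  classical
  induction n with
  | zero => intro p hp h _; exact ⟨p, hp, rfl, h⟩
  | succ n ih =>
    intro p hp h hc
    obtain ⟨a, ha⟩ : (Finset.univ.filter
        (fun s => y s = C + 1 ∧ p s = C + 1)).Nonempty := by
      rw [← Finset.card_pos]; unfold TPc at h; omega
    obtain ⟨b, hb⟩ : (Finset.univ.filter
        (fun s => y s ≠ C + 1 ∧ p s ≠ C + 1 ∧ p s ≠ y s)).Nonempty := by
      rw [← Finset.card_pos]; omega
    have hA := ha
    have hB := hb
    simp only [Finset.mem_filter, Finset.mem_univ, true_and] at ha hb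
    obtain ⟨ha1, ha2⟩ := ha
    obtain ⟨hb1, hb2, hb3⟩ := hb
    have hab : a ≠ b := by rintro rfl; exact hb1 ha1
    set q : S → ℕ := fun s => p (Equiv.swap a b s) with hq
    have qa : q a = p b := by simp [hq]
    have qb : q b = C + 1 := by simp [hq, ha2]
    have qo : ∀ s, s ≠ a → s ≠ b → q s = p s := by
      intro s h1 h2; simp [hq, Equiv.swap_apply_of_ne_of_ne h1 h2]
    have hTP : ∀ c ∈ Finset.Icc 1 C, TPc y q c = TPc y p c := by
      intro c hcc
      rw [Finset.mem_Icc] at hcc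
      unfold TPc
      congr 1
      ext s
      simp only [Finset.mem_filter, Finset.mem_univ, true_and]
      by_cases h1 : s = a
      · subst h1; omega
      by_cases h2 : s = b
      · subst h2; omega
      rw [qo s h1 h2]
    have hFN : ∀ c ∈ Finset.Icc 1 C, FNc y q c = FNc y p c := by
      intro c hcc
      rw [Finset.mem_Icc] at hcc
      unfold FNc
      congr 1
      ext s
      simp only [Finset.mem_filter, Finset.mem_univ, true_and]
      by_cases h1 : s = a
      · subst h1; omega
      by_cases h2 : s = b
      · subst h2; omega
      rw [qo s h1 h2]
    have hFP : ∀ c ∈ Finset.Icc 1 C, FPc y q c = FPc y p c := by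
      intro c hcc
      rw [Finset.mem_Icc] at hcc
      unfold FPc
      refine Finset.card_equiv (Equiv.swap a b) ?_
      intro s
      simp only [Finset.mem_filter, Finset.mem_univ, true_and]
      by_cases h1 : s = a
      · subst h1; rw [Equiv.swap_apply_left]; omega
      by_cases h2 : s = b
      · subst h2; rw [Equiv.swap_apply_right]; omega
      rw [qo s h1 h2, Equiv.swap_apply_of_ne_of_ne h1 h2]
    have hF : FMacro y q C = FMacro y p C := by
      have e1 : PkMacro y q C = PkMacro y p C := by
        unfold PkMacro
        congr 1
        exact Finset.sum_congr rfl (fun c hcc => by rw [hTP c hcc, hFP c hcc])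
      have e2 : TPRkMacro y q C = TPRkMacro y p C := by
        unfold TPRkMacro
        congr 1
        exact Finset.sum_congr rfl (fun c hcc => by rw [hTP c hcc, hFN c hcc])
      unfold FMacro
      rw [e1, e2]
    have hn : TPc y q (C + 1) = n := by
      have e : Finset.univ.filter (fun s => y s = C + 1 ∧ q s = C + 1) =
          (Finset.univ.filter (fun s => y s = C + 1 ∧ p s = C + 1)).erase a := by
        ext s
        simp only [Finset.mem_filter, Finset.mem_univ, true_and, Finset.mem_erase]
        by_cases h1 : s = a
        · subst h1; simp; omega
        by_cases h2 : s = b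
        · subst h2; simp [hb1]
        rw [qo s h1 h2]; simp [h1]
      unfold TPc at h ⊢
      rw [e, Finset.card_erase_of_mem hA, h]; rfl
    have hm : n ≤ (Finset.univ.filter
        (fun s => y s ≠ C + 1 ∧ q s ≠ C + 1 ∧ q s ≠ y s)).card := by
      have e : Finset.univ.filter (fun s => y s ≠ C + 1 ∧ q s ≠ C + 1 ∧ q s ≠ y s) =
          (Finset.univ.filter
            (fun s => y s ≠ C + 1 ∧ p s ≠ C + 1 ∧ p s ≠ y s)).erase b := by
        ext s
        simp only [Finset.mem_filter, Finset.mem_univ, true_and, Finset.mem_erase]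
        by_cases h1 : s = a
        · subst h1; simp [ha1]
        by_cases h2 : s = b
        · subst h2; simp [qb]
        rw [qo s h1 h2]; simp [h2]
      rw [e, Finset.card_erase_of_mem hB]; omega
    obtain ⟨pt, h1, h2, h3⟩ := ih q (fun s => hp _) hn hm
    exact ⟨pt, h1, h2.trans hF, h3⟩

/-- Inconsistency Property I for the macro open-set F-score. -/
theorem inconsistency_property_I_macro_fscore
    {S : Type*} [Fintype S] [Nonempty S] (C : ℕ) (hC : 1 ≤ C)
    (y p : S → ℕ)
    (hy : ∀ s, y s ∈ Finset.Icc 1 (C + 1))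
    (hp : ∀ s, p s ∈ Finset.Icc 1 (C + 1))
    (hcond : TPc y p (C + 1) ≤
      (Finset.univ.filter (fun s => y s ≠ C + 1 ∧ p s ≠ C + 1 ∧ p s ≠ y s)).card) :
    ∃ pt : S → ℕ,
      (∀ s, pt s ∈ Finset.Icc 1 (C + 1)) ∧
      FMacro y pt C = FMacro y p C ∧
      TPc y pt (C + 1) = 0 := by
  exact swap_step_aux C y _ p hp rfl hcond
end

section
/- In the confusion-matrix OSR setting, suppose the number of close-set samples predicted into a wrong known class, i.e. #{s ∈ S : y s ≠ C+1 ∧ p s ≠ C+1 ∧ p s ≠ y s}, is at least TP_{C+1}(p). Then there exists a prediction map p̃ : S → {1,…,C+1} such that Youden's index satisfies J(p̃) = J(p) while TP_{C+1}(p̃) = 0, i.e. p̃ classifies every open-set sample into a known class. -/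
open Finset

/-- Macro TNR over the known classes `1,…,C`. -/
noncomputable def TNRkMacro {S : Type*} [Fintype S] (y q : S → ℕ) (C : ℕ) : ℝ :=
  (1 / (C : ℝ)) *
    ∑ c ∈ Finset.Icc 1 C, (TNc y q c : ℝ) / ((TNc y q c : ℝ) + (FPc y q c : ℝ))

/-- Youden's index. -/
noncomputable def YoudenJ {S : Type*} [Fintype S] (y q : S → ℕ) (C : ℕ) : ℝ :=
  TPRkMacro y q C + TNRkMacro y q C - 1

theorem exists_swap_involution {S : Type*} (A B : Finset S) (hd : ∀ s ∈ A, s ∉ B)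
    (h : A.card ≤ B.card) :
    ∃ σ : S → S, Function.Involutive σ ∧ (∀ s ∈ A, σ s ∈ B) ∧
      ∀ s, s ∉ A → σ s ∈ A ∨ σ s = s := by
  classical
  obtain ⟨f⟩ : Nonempty (A ↪ B) :=
    Function.Embedding.nonempty_of_card_le (by simpa using h)
  let g : S → S := fun s => if h : s ∈ A then (f ⟨s, h⟩ : S) else s
  have gB : ∀ s ∈ A, g s ∈ B := by
    intro s hs
    simp only [g, hs, dite_true]
    exact (f ⟨s, hs⟩).2
  have ginj : ∀ s ∈ A, ∀ t ∈ A, g s = g t → s = t := by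
    intro s hs t ht hst
    simp only [g, hs, ht, dite_true] at hst
    have := f.injective (Subtype.ext hst)
    exact congrArg Subtype.val this
  let σ : S → S := fun s => if s ∈ A then g s else
    if h : ∃ a, a ∈ A ∧ g a = s then h.choose else s
  have s1 : ∀ s ∈ A, σ s = g s := fun s hs => by simp only [σ, hs, if_true]
  have s2 : ∀ a ∈ A, σ (g a) = a := by
    intro a ha
    have hn : g a ∉ A := fun hh => hd _ hh (gB a ha)
    have he : ∃ b, b ∈ A ∧ g b = g a := ⟨a, ha, rfl⟩
    simp only [σ, hn, if_false, he, dite_true]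
    exact ginj _ he.choose_spec.1 _ ha he.choose_spec.2
  have s3 : ∀ s, s ∉ A → (¬ ∃ a, a ∈ A ∧ g a = s) → σ s = s := by
    intro s hs he
    simp only [σ, hs, if_false, he, dite_false]
  refine ⟨σ, ?_, ?_, ?_⟩
  · intro s
    by_cases hs : s ∈ A
    · rw [s1 s hs, s2 s hs]
    · by_cases he : ∃ a, a ∈ A ∧ g a = s
      · obtain ⟨a, ha, rfl⟩ := he
        rw [s2 a ha, s1 a ha]
      · rw [s3 s hs he, s3 s hs he]
  · intro s hs
    rw [s1 s hs]; exact gB s hs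
  · intro s hs
    by_cases he : ∃ a, a ∈ A ∧ g a = s
    · obtain ⟨a, ha, rfl⟩ := he
      left; rw [s2 a ha]; exact ha
    · right; exact s3 s hs he

theorem TPc_add_FNc {S : Type*} [Fintype S] (y q : S → ℕ) (c : ℕ) :
    TPc y q c + FNc y q c = (Finset.univ.filter (fun s => y s = c)).card := by
  rw [← Finset.card_filter_add_card_filter_not (s := Finset.univ.filter (fun s => y s = c))
    (fun s => q s = c), Finset.filter_filter, Finset.filter_filter]
  rfl

/-- Inconsistency Property I for Youden's index. -/
theorem inconsistency_property_I_youden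
    {S : Type*} [Fintype S] [Nonempty S] (C : ℕ) (hC : 1 ≤ C)
    (y p : S → ℕ)
    (hy : ∀ s, y s ∈ Finset.Icc 1 (C + 1))
    (hp : ∀ s, p s ∈ Finset.Icc 1 (C + 1))
    (hcond : TPc y p (C + 1) ≤
      (Finset.univ.filter (fun s => y s ≠ C + 1 ∧ p s ≠ C + 1 ∧ p s ≠ y s)).card) :
    ∃ pt : S → ℕ,
      (∀ s, pt s ∈ Finset.Icc 1 (C + 1)) ∧
      YoudenJ y pt C = YoudenJ y p C ∧
      TPc y pt (C + 1) = 0 := by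
  obtain ⟨σ, hinv, hA, hnA⟩ := exists_swap_involution
    (Finset.univ.filter (fun s => y s = C + 1 ∧ p s = C + 1))
    (Finset.univ.filter (fun s => y s ≠ C + 1 ∧ p s ≠ C + 1 ∧ p s ≠ y s))
    (by intro s h1 h2
        simp only [Finset.mem_filter, Finset.mem_univ, true_and] at h1 h2
        exact h2.1 h1.1) hcond
  simp only [Finset.mem_filter, Finset.mem_univ, true_and] at hA hnA
  -- for known classes, the wrong/right status is carried along by the involution
  have key : ∀ c, c ≤ C → ∀ s, p (σ s) = c → (y s = c ↔ y (σ s) = c) := by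
    intro c hc s hs
    by_cases h : y s = C + 1 ∧ p s = C + 1
    · have := hA s h
      omega
    · rcases hnA s h with h' | h'
      · omega
      · rw [h']
  have hTP : ∀ c, c ≤ C → TPc y (p ∘ σ) c = TPc y p c := by
    intro c hc
    refine Finset.card_equiv hinv.toPerm fun s => ?_
    simp only [Finset.mem_filter, Finset.mem_univ, true_and, Function.comp,
      Function.Involutive.coe_toPerm]
    have := key c hc s
    tauto
  have hFP : ∀ c, c ≤ C → FPc y (p ∘ σ) c = FPc y p c := by
    intro c hc
    refine Finset.card_equiv hinv.toPerm fun s => ?_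
    simp only [Finset.mem_filter, Finset.mem_univ, true_and, Function.comp,
      Function.Involutive.coe_toPerm]
    have := key c hc s
    tauto
  refine ⟨p ∘ σ, fun s => hp _, ?_, ?_⟩
  · unfold YoudenJ TPRkMacro TNRkMacro
    congr 2
    · congr 1
      refine Finset.sum_congr rfl fun c hc => ?_
      have hc := (Finset.mem_Icc.1 hc).2
      have h1 := TPc_add_FNc y p c
      have h2 := TPc_add_FNc y (p ∘ σ) c
      rw [hTP c hc] at h2 ⊢
      rw [show FNc y (p ∘ σ) c = FNc y p c by omega]
    · congr 1
      refine Finset.sum_congr rfl fun c hc => ?_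
      have hc := (Finset.mem_Icc.1 hc).2
      have h1 := FPc_add_TNc y p c
      have h2 := FPc_add_TNc y (p ∘ σ) c
      rw [hFP c hc] at h2 ⊢
      rw [show TNc y (p ∘ σ) c = TNc y p c by omega]
  · unfold TPc
    rw [Finset.card_eq_zero, Finset.filter_eq_empty_iff]
    rintro s - ⟨h1, h2⟩
    simp only [Function.comp] at h2
    by_cases h : y s = C + 1 ∧ p s = C + 1
    · exact (hA s h).2.1 h2
    · rcases hnA s h with h' | h'
      · have := hA _ h'
        rw [hinv s] at this
        exact this.1 h1
      · rw [h'] at h2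
        exact h ⟨h1, h2⟩
end

section
/- In the confusion-matrix OSR setting with balance constant λ ∈ (0,1), suppose there exist samples s1, s2 ∈ S with y s1 = C+1 and p s1 = C+1 (a correctly rejected open-set sample), y s2 ≠ C+1 and p s2 = C+1 (a wrongly rejected close-set sample), and suppose TP_{C+1}(p) > FP_{C+1}(p). Define p̃ by p̃ s1 = y s2, p̃ s2 = y s2, and p̃ s = p s for all other s. Then NAcc(p̃) > NAcc(p) while TP_{C+1}(p̃) = TP_{C+1}(p) − 1; that is, Normalized Accuracy strictly increases although one more open-set sample is misclassified into a known class (Inconsistency Property II). -/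
open Finset

/-- Accuracy on Known Samples. -/
noncomputable def AKS {S : Type*} [Fintype S] (y q : S → ℕ) (C : ℕ) : ℝ :=
  (∑ c ∈ Finset.Icc 1 C, ((TPc y q c : ℝ) + (TNc y q c : ℝ))) /
    (∑ c ∈ Finset.Icc 1 C,
      ((TPc y q c : ℝ) + (TNc y q c : ℝ) + (FPc y q c : ℝ) + (FNc y q c : ℝ)))

/-- Accuracy on Unknown Samples. -/
noncomputable def AUS {S : Type*} [Fintype S] (y q : S → ℕ) (C : ℕ) : ℝ :=
  (TPc y q (C + 1) : ℝ) / ((TPc y q (C + 1) : ℝ) + (FPc y q (C + 1) : ℝ))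

/-- Normalized Accuracy with balance constant `lam`. -/
noncomputable def NAcc {S : Type*} [Fintype S] (y q : S → ℕ) (C : ℕ) (lam : ℝ) : ℝ :=
  lam * AKS y q C + (1 - lam) * AUS y q C

theorem total_eq {S : Type*} [Fintype S] (y q : S → ℕ) (c : ℕ) :
    TPc y q c + TNc y q c + FPc y q c + FNc y q c = Fintype.card S := by
  unfold TPc TNc FPc FNc
  simp only [Finset.card_filter, ← Finset.sum_add_distrib]
  rw [← Finset.card_univ, Finset.card_eq_sum_ones]
  apply Finset.sum_congr rfl
  intro s _
  by_cases h1 : y s = c <;> by_cases h2 : q s = c <;> simp [h1, h2]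

/-- Inconsistency Property II: Normalized Accuracy strictly increases although one more
open-set sample is misclassified into a known class. -/
theorem inconsistency_property_II
    {S : Type*} [Fintype S] [DecidableEq S] [Nonempty S] (C : ℕ) (hC : 1 ≤ C)
    (lam : ℝ) (hlam0 : 0 < lam) (hlam1 : lam < 1)
    (y p : S → ℕ)
    (hy : ∀ s, y s ∈ Finset.Icc 1 (C + 1))
    (hp : ∀ s, p s ∈ Finset.Icc 1 (C + 1))
    (s1 s2 : S)
    (hs1y : y s1 = C + 1) (hs1p : p s1 = C + 1)
    (hs2y : y s2 ≠ C + 1) (hs2p : p s2 = C + 1)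
    (hTPFP : FPc y p (C + 1) < TPc y p (C + 1)) :
    NAcc y (fun s => if s = s1 then y s2 else if s = s2 then y s2 else p s) C lam >
        NAcc y p C lam ∧
      TPc y (fun s => if s = s1 then y s2 else if s = s2 then y s2 else p s) (C + 1) =
        TPc y p (C + 1) - 1 := by
  set q : S → ℕ := fun s => if s = s1 then y s2 else if s = s2 then y s2 else p s with hq
  have hne : s1 ≠ s2 := by
    rintro rfl
    exact hs2y hs1y
  have hq1 : q s1 = y s2 := by simp [hq]
  have hq2 : q s2 = y s2 := by simp [hq]
  have hq3 : ∀ s, s ≠ s1 → s ≠ s2 → q s = p s := by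
    intro s h1 h2
    simp [hq, h1, h2]
  clear_value q
  have hTP : TPc y q (C + 1) + 1 = TPc y p (C + 1) := by
    unfold TPc
    rw [← Finset.card_erase_add_one (s := univ.filter (fun s => y s = C + 1 ∧ p s = C + 1))
      (a := s1) (by simp [hs1y, hs1p])]
    congr 2
    ext s
    simp only [mem_filter, mem_erase, mem_univ, true_and]
    grind
  have hFP : FPc y q (C + 1) + 1 = FPc y p (C + 1) := by
    unfold FPc
    rw [← Finset.card_erase_add_one (s := univ.filter (fun s => y s ≠ C + 1 ∧ p s = C + 1))
      (a := s2) (by simp [hs2y, hs2p])]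
    congr 2
    ext s
    simp only [mem_filter, mem_erase, mem_univ, true_and]
    grind
  have hnum : ∀ c ∈ Finset.Icc 1 C, TPc y q c + TNc y q c = TPc y p c + TNc y p c := by
    intro c hc
    rw [Finset.mem_Icc] at hc
    have hcC : c ≠ C + 1 := by omega
    by_cases h : c = y s2
    · have h1 : TPc y q c = TPc y p c + 1 := by
        unfold TPc
        rw [← Finset.card_erase_add_one (s := univ.filter (fun s => y s = c ∧ q s = c))
          (a := s2) (by simp [h, hq2])]
        congr 2
        ext s
        simp only [mem_filter, mem_erase, mem_univ, true_and]
        grind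
      have h2 : TNc y q c + 1 = TNc y p c := by
        unfold TNc
        rw [← Finset.card_erase_add_one (s := univ.filter (fun s => y s ≠ c ∧ p s ≠ c))
          (a := s1) (by simp only [mem_filter, mem_univ, true_and]; grind)]
        congr 2
        ext s
        simp only [mem_filter, mem_erase, mem_univ, true_and]
        grind
      omega
    · have h1 : TPc y q c = TPc y p c := by
        unfold TPc
        congr 1
        ext s
        simp only [mem_filter, mem_univ, true_and]
        grind
      have h2 : TNc y q c = TNc y p c := by
        unfold TNc
        congr 1
        ext s
        simp only [mem_filter, mem_univ, true_and]
        grind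
      omega
  have hAKS : AKS y q C = AKS y p C := by
    have e1 : ∀ c ∈ Finset.Icc 1 C, (TPc y q c : ℝ) + TNc y q c = TPc y p c + TNc y p c := by
      intro c hc
      exact_mod_cast hnum c hc
    have e2 : ∀ c ∈ Finset.Icc 1 C, (TPc y q c : ℝ) + TNc y q c + FPc y q c + FNc y q c
        = TPc y p c + TNc y p c + FPc y p c + FNc y p c := by
      intro c _
      have := total_eq y q c
      rw [← total_eq y p c] at this
      exact_mod_cast this
    unfold AKS
    rw [Finset.sum_congr rfl e1, Finset.sum_congr rfl e2]
  have hAUS : AUS y p C < AUS y q C := by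
    unfold AUS
    rw [← hTP, ← hFP]
    have hlt : (FPc y q (C + 1) : ℝ) < TPc y q (C + 1) := by
      exact_mod_cast (by omega : FPc y q (C + 1) < TPc y q (C + 1))
    have h0 : (0 : ℝ) ≤ FPc y q (C + 1) := Nat.cast_nonneg _
    push_cast
    rw [div_lt_div_iff₀ (by linarith) (by linarith)]
    nlinarith
  refine ⟨?_, by omega⟩
  unfold NAcc
  rw [hAKS]
  have := mul_lt_mul_of_pos_left hAUS (sub_pos.mpr hlam1)
  linarith
end

section
/- In the empirical OSR setting, suppose there are indices i1, i2 ∈ K and j3 ∈ U with h i1 = y i1 (i1 is correctly classified), h i2 ≠ y i2 (i2 is misclassified), and rk i2 > ru j3 > rk i1. Define rk' by rk' i1 = rk i2, rk' i2 = rk i1, and rk' i = rk i for all other i ∈ K. Then the close-set accuracy Acc(h) is unchanged, the empirical AUC satisfies AUC(rk', ru) = AUC(rk, ru) — hence for every aggregation function agg : ℝ×ℝ → ℝ, agg(Acc(h), AUC(rk', ru)) = agg(Acc(h), AUC(rk, ru)) — and yet OpenAUC(h, rk', ru) < OpenAUC(h, rk, ru) (Inconsistency Property III). -/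
open Finset

/-- Close-set accuracy. -/
noncomputable def accK {K : Type*} [Fintype K] (y h : K → ℕ) : ℝ :=
  (1 / (Fintype.card K : ℝ)) * ∑ i : K, if h i = y i then (1 : ℝ) else 0

/-- Empirical AUC between close-set scores `rk` and open-set scores `ru`. -/
noncomputable def AUC {K U : Type*} [Fintype K] [Fintype U] (rk : K → ℝ) (ru : U → ℝ) : ℝ :=
  (1 / ((Fintype.card K : ℝ) * (Fintype.card U : ℝ))) *
    ∑ i : K, ∑ j : U, if ru j > rk i then (1 : ℝ) else 0

/-- Empirical OpenAUC. -/
noncomputable def OpenAUC {K U : Type*} [Fintype K] [Fintype U]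
    (y h : K → ℕ) (rk : K → ℝ) (ru : U → ℝ) : ℝ :=
  (1 / ((Fintype.card K : ℝ) * (Fintype.card U : ℝ))) *
    ∑ i : K, ∑ j : U,
      (if h i = y i then (1 : ℝ) else 0) * (if ru j > rk i then (1 : ℝ) else 0)

/-- Inconsistency Property III: swapping the scores of a correctly classified and a
misclassified close-set sample around an open-set score leaves the close-set accuracy
and the empirical AUC (hence any aggregation of the two) unchanged, yet strictly
decreases OpenAUC. -/
theorem inconsistency_property_III
    {K U : Type*} [Fintype K] [DecidableEq K] [Fintype U] [Nonempty K] [Nonempty U]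
    (y h : K → ℕ) (rk : K → ℝ) (ru : U → ℝ)
    (i1 i2 : K) (j3 : U)
    (hi1 : h i1 = y i1) (hi2 : h i2 ≠ y i2)
    (h21 : rk i2 > ru j3) (h13 : ru j3 > rk i1) :
    AUC (fun i => if i = i1 then rk i2 else if i = i2 then rk i1 else rk i) ru
        = AUC rk ru ∧
      (∀ agg : ℝ → ℝ → ℝ,
        agg (accK y h)
            (AUC (fun i => if i = i1 then rk i2 else if i = i2 then rk i1 else rk i) ru)
          = agg (accK y h) (AUC rk ru)) ∧
      OpenAUC y h (fun i => if i = i1 then rk i2 else if i = i2 then rk i1 else rk i) ru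
        < OpenAUC y h rk ru := by
  have key : AUC (fun i => if i = i1 then rk i2 else if i = i2 then rk i1 else rk i) ru
        = AUC rk ru := by
    have hs : (fun i => if i = i1 then rk i2 else if i = i2 then rk i1 else rk i)
        = fun i => rk (Equiv.swap i1 i2 i) := by
      funext i
      rw [Equiv.swap_apply_def]
      split_ifs <;> rfl
    rw [hs]
    unfold AUC
    congr 1
    exact Equiv.sum_comp (Equiv.swap i1 i2)
      (fun i => ∑ j : U, if ru j > rk i then (1 : ℝ) else 0)
  refine ⟨key, fun agg => by rw [key], ?_⟩
  unfold OpenAUC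
  have hK : (0 : ℝ) < Fintype.card K := by exact_mod_cast Fintype.card_pos
  have hU : (0 : ℝ) < Fintype.card U := by exact_mod_cast Fintype.card_pos
  apply mul_lt_mul_of_pos_left _ (by positivity)
  have hle : ∀ i : K, ∀ j : U,
      (if h i = y i then (1 : ℝ) else 0) *
        (if ru j > (if i = i1 then rk i2 else if i = i2 then rk i1 else rk i)
          then (1 : ℝ) else 0)
      ≤ (if h i = y i then (1 : ℝ) else 0) * (if ru j > rk i then (1 : ℝ) else 0) := by
    intro i j
    by_cases e1 : i = i1
    · subst e1
      rw [if_pos hi1, if_pos rfl, one_mul, one_mul]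
      split_ifs with a b
      · exact le_rfl
      · exact absurd (show ru j > rk i by linarith) b
      · exact zero_le_one
      · exact le_rfl
    · by_cases e2 : i = i2
      · subst e2
        simp [hi2]
      · simp [e1, e2]
  refine Finset.sum_lt_sum (fun i _ => Finset.sum_le_sum fun j _ => hle i j)
    ⟨i1, Finset.mem_univ _, Finset.sum_lt_sum (fun j _ => hle i1 j) ⟨j3, Finset.mem_univ _, ?_⟩⟩
  simp [hi1, h13, not_lt.mpr (le_of_lt h21)]
end

section
/- In the empirical OSR setting, let (h̃, rk̃, ru') satisfy: [h̃ i = y i] = [h i = y i] for every i ∈ K (the set of correctly classified close-set samples is unchanged); rk̃ i = rk i for every i ∈ K with h i = y i; and there is an index j1 ∈ U with ru' j1 ≤ ru j1 and ru' j = ru j for all j ∈ U with j ≠ j1. Then OpenAUC(h̃, rk̃, ru') ≤ OpenAUC(h, rk, ru). Moreover, if there exists i ∈ K with h i = y i and ru' j1 ≤ rk i < ru j1, then the inequality is strict: OpenAUC(h̃, rk̃, ru') < OpenAUC(h, rk, ru). In particular, the modification used in Inconsistency Property I (lowering the open-set score of an open-set sample so that it is accepted as a known class, while changing predictions only on misclassified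 close-set samples) cannot increase OpenAUC. -/
open Finset

/-- OpenAUC is free from Inconsistency Property I: keeping the set of correctly
classified close-set samples (and their scores) fixed while lowering the open-set score
of some open-set sample cannot increase OpenAUC, and strictly decreases it as soon as
some correctly classified close-set sample's score separates the old and new scores. -/
theorem openAUC_no_inconsistency_I
    {K U : Type*} [Fintype K] [Fintype U] [DecidableEq U] [Nonempty K] [Nonempty U]
    (y h ht : K → ℕ) (rk rkt : K → ℝ) (ru ru' : U → ℝ)
    (hcorrect : ∀ i : K, (ht i = y i) ↔ (h i = y i))
    (hscores : ∀ i : K, h i = y i → rkt i = rk i)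
    (j1 : U) (hj1 : ru' j1 ≤ ru j1)
    (hother : ∀ j : U, j ≠ j1 → ru' j = ru j) :
    OpenAUC y ht rkt ru' ≤ OpenAUC y h rk ru ∧
      ((∃ i : K, h i = y i ∧ ru' j1 ≤ rk i ∧ rk i < ru j1) →
        OpenAUC y ht rkt ru' < OpenAUC y h rk ru) := by
  have hle : ∀ j, ru' j ≤ ru j := by
    intro j
    by_cases hj : j = j1
    · rw [hj]; exact hj1
    · exact (hother j hj).le
  have hterm : ∀ i j, (if ht i = y i then (1 : ℝ) else 0) * (if ru' j > rkt i then (1 : ℝ) else 0)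
      ≤ (if h i = y i then (1 : ℝ) else 0) * (if ru j > rk i then (1 : ℝ) else 0) := by
    intro i j
    by_cases hc : h i = y i
    · have h1 := (hcorrect i).2 hc
      have h2 := hscores i hc
      rw [if_pos hc, if_pos h1, h2, one_mul, one_mul]
      by_cases h3 : ru' j > rk i
      · rw [if_pos h3, if_pos (lt_of_lt_of_le h3 (hle j))]
      · rw [if_neg h3]
        split_ifs <;> norm_num
    · have h1 : ¬ ht i = y i := fun e => hc ((hcorrect i).1 e)
      rw [if_neg hc, if_neg h1, zero_mul, zero_mul]
  have hpos : (0 : ℝ) < 1 / ((Fintype.card K : ℝ) * (Fintype.card U : ℝ)) := by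
    have hK : (0 : ℝ) < Fintype.card K := by exact_mod_cast Fintype.card_pos
    have hU : (0 : ℝ) < Fintype.card U := by exact_mod_cast Fintype.card_pos
    positivity
  unfold OpenAUC
  refine ⟨mul_le_mul_of_nonneg_left
    (Finset.sum_le_sum fun i _ => Finset.sum_le_sum fun j _ => hterm i j) hpos.le, ?_⟩
  rintro ⟨i, hc, ha, hb⟩
  refine mul_lt_mul_of_pos_left ?_ hpos
  refine Finset.sum_lt_sum (fun i _ => Finset.sum_le_sum fun j _ => hterm i j)
    ⟨i, Finset.mem_univ i, ?_⟩
  refine Finset.sum_lt_sum (fun j _ => hterm i j) ⟨j1, Finset.mem_univ j1, ?_⟩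
  rw [if_pos hc, if_pos ((hcorrect i).2 hc), hscores i hc, if_pos hb, if_neg (not_lt.2 ha)]
  norm_num
end

section
/- In the empirical OSR setting with rejection threshold t ∈ ℝ, if OpenAUC(h, rk, ru) = k and FPR_{C+1}(t) = a with a ≠ 0, then TPR_{C+1}(t) ≥ 1 − (1 − k)/a. -/
open Finset

/-- FPR of the unknown class at threshold `t`: fraction of close-set samples rejected. -/
noncomputable def FPRopen {K : Type*} [Fintype K] (rk : K → ℝ) (t : ℝ) : ℝ :=
  ((Finset.univ.filter (fun i => rk i > t)).card : ℝ) / (Fintype.card K : ℝ)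

/-- TPR of the unknown class at threshold `t`: fraction of open-set samples rejected. -/
noncomputable def TPRopen {U : Type*} [Fintype U] (ru : U → ℝ) (t : ℝ) : ℝ :=
  ((Finset.univ.filter (fun j => ru j > t)).card : ℝ) / (Fintype.card U : ℝ)

/-- If `OpenAUC = k` and `FPR_{C+1}(t) = a ≠ 0`, then `TPR_{C+1}(t) ≥ 1 − (1 − k)/a`. -/
theorem openAUC_TPR_lower_bound
    {K U : Type*} [Fintype K] [Fintype U] [Nonempty K] [Nonempty U]
    (y h : K → ℕ) (rk : K → ℝ) (ru : U → ℝ) (t k a : ℝ)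
    (hk : OpenAUC y h rk ru = k)
    (ha : FPRopen rk t = a) (ha0 : a ≠ 0) :
    TPRopen ru t ≥ 1 - (1 - k) / a := by
  have hn : (0 : ℝ) < Fintype.card K := by exact_mod_cast Fintype.card_pos
  have hm : (0 : ℝ) < Fintype.card U := by exact_mod_cast Fintype.card_pos
  have hterm : ∀ i j, (if h i = y i then (1 : ℝ) else 0) * (if ru j > rk i then (1 : ℝ) else 0)
      ≤ 1 - (if rk i > t then (1 : ℝ) else 0) * (1 - (if ru j > t then (1 : ℝ) else 0)) := by
    intro i j
    by_cases h1 : h i = y i <;> by_cases h2 : ru j > rk i <;> by_cases h3 : rk i > t <;>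
      by_cases h4 : ru j > t <;> simp only [h1, h2, h3, h4, if_true, if_false] <;>
      first
        | exact absurd (lt_trans h3 h2) h4
        | norm_num
  have hsum := Finset.sum_le_sum (s := (Finset.univ : Finset K)) fun i _ =>
    Finset.sum_le_sum (s := (Finset.univ : Finset U)) fun j _ => hterm i j
  have hR : ∑ i : K, ∑ j : U,
      (1 - (if rk i > t then (1 : ℝ) else 0) * (1 - (if ru j > t then (1 : ℝ) else 0)))
      = (Fintype.card K : ℝ) * Fintype.card U
        - ((Finset.univ.filter (fun i => rk i > t)).card : ℝ) *
          (Fintype.card U - ((Finset.univ.filter (fun j => ru j > t)).card : ℝ)) := by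
    simp only [Finset.sum_sub_distrib, ← Finset.mul_sum, ← Finset.sum_mul, Finset.sum_boole]
    simp
  rw [hR] at hsum
  have hapos : 0 < a := by
    refine lt_of_le_of_ne ?_ (Ne.symm ha0)
    rw [← ha]
    unfold FPRopen
    positivity
  have hle : k ≤ 1 - a * (1 - TPRopen ru t) := by
    rw [← hk, ← ha]
    unfold OpenAUC FPRopen TPRopen
    rw [one_div_mul_eq_div, div_le_iff₀ (mul_pos hn hm)]
    refine hsum.trans (le_of_eq ?_)
    field_simp
  have h2 : 1 - TPRopen ru t ≤ (1 - k) / a := by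
    rw [le_div_iff₀ hapos]
    linarith
  linarith
end

section
/- In the empirical OSR setting with rejection threshold t ∈ ℝ, if OpenAUC(h, rk, ru) = k and FPR_{C+1}(t) = a with a > 1 − k, then TPR_{C+1}(t) > 0, i.e. at least one open-set sample is correctly rejected. -/
open Finset

/-- If `OpenAUC = k` and `FPR_{C+1}(t) = a > 1 − k`, then `TPR_{C+1}(t) > 0`:
at least one open-set sample is correctly rejected. -/
theorem openAUC_TPR_pos
    {K U : Type*} [Fintype K] [Fintype U] [Nonempty K] [Nonempty U]
    (y h : K → ℕ) (rk : K → ℝ) (ru : U → ℝ) (t k a : ℝ)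
    (hk : OpenAUC y h rk ru = k)
    (ha : FPRopen rk t = a) (ha0 : a > 1 - k) :
    TPRopen ru t > 0 := by
  have hK : (0 : ℝ) < Fintype.card K := by exact_mod_cast Fintype.card_pos
  have hU : (0 : ℝ) < Fintype.card U := by exact_mod_cast Fintype.card_pos
  by_cases hex : ∃ j, ru j > t
  · obtain ⟨j, hj⟩ := hex
    have hc : 0 < (Finset.univ.filter (fun j => ru j > t)).card :=
      Finset.card_pos.mpr ⟨j, by simpa using hj⟩
    unfold TPRopen
    exact div_pos (by exact_mod_cast hc) hU
  · exfalso
    have hall : ∀ j, ru j ≤ t := fun j => not_lt.mp fun hj => hex ⟨j, hj⟩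
    have hsum : ∑ i : K, ∑ j : U,
        (if h i = y i then (1 : ℝ) else 0) * (if ru j > rk i then (1 : ℝ) else 0)
        ≤ ∑ i : K, ∑ _j : U, (1 - (if rk i > t then (1 : ℝ) else 0)) := by
      refine Finset.sum_le_sum fun i _ => Finset.sum_le_sum fun j _ => ?_
      have := hall j
      split_ifs <;> first | linarith | norm_num
    have hval : ∑ i : K, ∑ _j : U, (1 - (if rk i > t then (1 : ℝ) else 0))
        = (Fintype.card U : ℝ) * ((Fintype.card K : ℝ)
          - ((Finset.univ.filter (fun i => rk i > t)).card : ℝ)) := by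
      simp only [Finset.sum_const, nsmul_eq_mul, Finset.card_univ, ← Finset.mul_sum,
        Finset.sum_sub_distrib, Finset.sum_boole, mul_one]
    rw [hval] at hsum
    have hle : k ≤ 1 - a := by
      rw [← hk, ← ha]
      unfold OpenAUC FPRopen
      rw [one_div_mul_eq_div, div_le_iff₀ (mul_pos hK hU)]
      refine hsum.trans (le_of_eq ?_)
      field_simp
    linarith
end

section
/- In the empirical OSR setting, for every threshold t ∈ ℝ, 1 − AUC(rk, ru) ≥ (FP_{C+1}(t) · FN_{C+1}(t))/(|K|·|U|), where FP_{C+1}(t) = #{i ∈ K : rk i > t} is the number of close-set samples rejected at threshold t and FN_{C+1}(t) = #{j ∈ U : ru j ≤ t} is the number of open-set samples accepted at threshold t; i.e. the number of mis-ranked close/open pairs is at least FP_{C+1}(t)·FN_{C+1}(t). -/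
open Finset

/-- The AUC risk dominates the product of the rejection error rates at any threshold:
`1 − AUC ≥ FP_{C+1}(t) · FN_{C+1}(t) / (|K|·|U|)`, where `FP_{C+1}(t)` counts the
close-set samples rejected at threshold `t` and `FN_{C+1}(t)` counts the open-set
samples accepted at threshold `t`. -/
theorem one_sub_AUC_ge_FP_mul_FN
    {K U : Type*} [Fintype K] [Fintype U] [Nonempty K] [Nonempty U]
    (rk : K → ℝ) (ru : U → ℝ) (t : ℝ) :
    1 - AUC rk ru ≥
      (((Finset.univ.filter (fun i => rk i > t)).card : ℝ) *
          ((Finset.univ.filter (fun j => ru j ≤ t)).card : ℝ)) /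
        ((Fintype.card K : ℝ) * (Fintype.card U : ℝ)) := by
  have hK : (0 : ℝ) < Fintype.card K := by exact_mod_cast Fintype.card_pos
  have hU : (0 : ℝ) < Fintype.card U := by exact_mod_cast Fintype.card_pos
  have hpos := mul_pos hK hU
  have hA : (((Finset.univ.filter (fun i => rk i > t)).card : ℝ) *
      ((Finset.univ.filter (fun j => ru j ≤ t)).card : ℝ)) =
      ∑ i : K, ∑ j : U, (if rk i > t then (1 : ℝ) else 0) * (if ru j ≤ t then (1 : ℝ) else 0) := by
    rw [← Finset.sum_mul_sum, Finset.sum_boole, Finset.sum_boole]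
  have hB : (Fintype.card K : ℝ) * (Fintype.card U : ℝ) = ∑ _i : K, ∑ _j : U, (1 : ℝ) := by
    simp
  have key : (((Finset.univ.filter (fun i => rk i > t)).card : ℝ) *
      ((Finset.univ.filter (fun j => ru j ≤ t)).card : ℝ)) +
      (∑ i : K, ∑ j : U, if ru j > rk i then (1 : ℝ) else 0) ≤
      (Fintype.card K : ℝ) * (Fintype.card U : ℝ) := by
    rw [hA, hB, ← Finset.sum_add_distrib]
    refine Finset.sum_le_sum fun i _ => ?_
    rw [← Finset.sum_add_distrib]
    refine Finset.sum_le_sum fun j _ => ?_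
    split_ifs <;> first | (exfalso; linarith) | norm_num
  unfold AUC
  rw [ge_iff_le, div_le_iff₀ hpos, sub_mul, one_mul, mul_right_comm, one_div,
    inv_mul_cancel₀ hpos.ne', one_mul]
  linarith
end

section
/- In the empirical OSR setting, suppose there are indices i1, i2 ∈ K and j3 ∈ U with h i1 = y i1 (i1 is correctly classified), h i2 ≠ y i2 (i2 is misclassified), and rk i2 > ru j3 > rk i1. Define rk' by rk' i1 = rk i2, rk' i2 = rk i1, and rk' i = rk i for all other i ∈ K. Then OpenAUC(h, rk, ru) − OpenAUC(h, rk', ru) = (1/(|K|·|U|))·#{j ∈ U : rk i1 < ru j ≤ rk i2} ≥ 1/(|K|·|U|); in particular OpenAUC(h, rk', ru) < OpenAUC(h, rk, ru). -/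
open Finset

/-- Quantitative version of Inconsistency Property III for OpenAUC: swapping the scores
of a correctly classified and a misclassified close-set sample around an open-set score
decreases OpenAUC by exactly the (normalized) number of open-set samples whose score
lies in `(rk i1, rk i2]`, which is at least `1/(|K|·|U|)`. -/
theorem openAUC_no_inconsistency_III
    {K U : Type*} [Fintype K] [DecidableEq K] [Fintype U] [Nonempty K] [Nonempty U]
    (y h : K → ℕ) (rk : K → ℝ) (ru : U → ℝ)
    (i1 i2 : K) (j3 : U)
    (hi1 : h i1 = y i1) (hi2 : h i2 ≠ y i2)
    (h21 : rk i2 > ru j3) (h13 : ru j3 > rk i1) :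
    OpenAUC y h rk ru -
        OpenAUC y h (fun i => if i = i1 then rk i2 else if i = i2 then rk i1 else rk i) ru
      = (1 / ((Fintype.card K : ℝ) * (Fintype.card U : ℝ))) *
          ((Finset.univ.filter (fun j => rk i1 < ru j ∧ ru j ≤ rk i2)).card : ℝ) ∧
    OpenAUC y h rk ru -
        OpenAUC y h (fun i => if i = i1 then rk i2 else if i = i2 then rk i1 else rk i) ru
      ≥ 1 / ((Fintype.card K : ℝ) * (Fintype.card U : ℝ)) ∧
    OpenAUC y h (fun i => if i = i1 then rk i2 else if i = i2 then rk i1 else rk i) ru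
      < OpenAUC y h rk ru := by
  have hlt : rk i1 < rk i2 := lt_trans h13 h21
  have hpos : 0 < 1 / ((Fintype.card K : ℝ) * (Fintype.card U : ℝ)) := by
    have h1 : 0 < Fintype.card K := Fintype.card_pos
    have h2 : 0 < Fintype.card U := Fintype.card_pos
    positivity
  have hcard : (1 : ℝ) ≤
      ((Finset.univ.filter (fun j => rk i1 < ru j ∧ ru j ≤ rk i2)).card : ℝ) := by
    have : 0 < (Finset.univ.filter (fun j => rk i1 < ru j ∧ ru j ≤ rk i2)).card :=
      Finset.card_pos.mpr ⟨j3, by simp [h13, h21.le]⟩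
    exact_mod_cast this
  have key : OpenAUC y h rk ru -
        OpenAUC y h (fun i => if i = i1 then rk i2 else if i = i2 then rk i1 else rk i) ru
      = (1 / ((Fintype.card K : ℝ) * (Fintype.card U : ℝ))) *
          ((Finset.univ.filter (fun j => rk i1 < ru j ∧ ru j ≤ rk i2)).card : ℝ) := by
    unfold OpenAUC
    rw [← mul_sub, ← Finset.sum_sub_distrib]
    congr 1
    rw [Finset.sum_eq_single i1]
    · rw [← Finset.sum_sub_distrib, Finset.card_filter]
      push_cast
      refine Finset.sum_congr rfl fun j _ => ?_
      simp only [hi1, if_true, one_mul, gt_iff_lt]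
      by_cases ha : rk i1 < ru j
      · by_cases hb : rk i2 < ru j
        · simp [ha, hb]
        · simp [ha, hb, not_lt.mp hb]
      · have hb : ¬ rk i2 < ru j := fun hb => ha (hlt.trans hb)
        simp [ha, hb]
    · intro i _ hi
      by_cases hii : i = i2
      · subst hii
        simp [hi2]
      · simp [hi, hii]
    · simp
  have hge : 1 / ((Fintype.card K : ℝ) * (Fintype.card U : ℝ)) ≤ OpenAUC y h rk ru -
        OpenAUC y h (fun i => if i = i1 then rk i2 else if i = i2 then rk i1 else rk i) ru := by
    rw [key]
    exact le_mul_of_one_le_right hpos.le hcard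
  exact ⟨key, hge, by linarith⟩
end

section
/- In the empirical OSR setting, the OpenAUC risk decomposes as a conditional combination of the close-set error and the open-set AUC risk: 1 − OpenAUC(h, rk, ru) = (1/|K|)·Σ_{i∈K}[h i ≠ y i] + (1/(|K|·|U|))·Σ_{i∈K}Σ_{j∈U}[h i = y i]·[ru j ≤ rk i]. -/
open Finset

/-- The OpenAUC risk decomposes as the close-set error plus the conditional
open-set AUC risk. -/
theorem openAUC_risk_decomposition
    {K U : Type*} [Fintype K] [Fintype U] [Nonempty K] [Nonempty U]
    (y h : K → ℕ) (rk : K → ℝ) (ru : U → ℝ) :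
    1 - OpenAUC y h rk ru =
      (1 / (Fintype.card K : ℝ)) * (∑ i : K, if h i ≠ y i then (1 : ℝ) else 0) +
        (1 / ((Fintype.card K : ℝ) * (Fintype.card U : ℝ))) *
          ∑ i : K, ∑ j : U,
            (if h i = y i then (1 : ℝ) else 0) * (if ru j ≤ rk i then (1 : ℝ) else 0) := by
  have hK : (Fintype.card K : ℝ) ≠ 0 := by exact_mod_cast Fintype.card_ne_zero
  have hU : (Fintype.card U : ℝ) ≠ 0 := by exact_mod_cast Fintype.card_ne_zero
  have key : (∑ i : K, ∑ j : U,
        (if h i = y i then (1 : ℝ) else 0) * (if ru j > rk i then (1 : ℝ) else 0)) +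
      (Fintype.card U : ℝ) * (∑ i : K, if h i ≠ y i then (1 : ℝ) else 0) +
      (∑ i : K, ∑ j : U,
        (if h i = y i then (1 : ℝ) else 0) * (if ru j ≤ rk i then (1 : ℝ) else 0)) =
      (Fintype.card K : ℝ) * (Fintype.card U : ℝ) := by
    have e : (Fintype.card K : ℝ) * (Fintype.card U : ℝ) = ∑ _i : K, ∑ _j : U, (1 : ℝ) := by
      simp
    have e2 : (Fintype.card U : ℝ) * (∑ i : K, if h i ≠ y i then (1 : ℝ) else 0) =
        ∑ i : K, ∑ _j : U, if h i ≠ y i then (1 : ℝ) else 0 := by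
      rw [Finset.mul_sum]
      refine Finset.sum_congr rfl fun i _ => ?_
      rw [Finset.sum_const, nsmul_eq_mul, Finset.card_univ]
    rw [e, e2, ← Finset.sum_add_distrib, ← Finset.sum_add_distrib]
    refine Finset.sum_congr rfl fun i _ => ?_
    rw [← Finset.sum_add_distrib, ← Finset.sum_add_distrib]
    refine Finset.sum_congr rfl fun j _ => ?_
    by_cases h1 : h i = y i <;> rcases lt_or_ge (rk i) (ru j) with h2 | h2
    · simp [h1, h2, not_le.mpr h2]
    · simp [h1, h2, not_lt.mpr h2]
    · simp [h1]
    · simp [h1]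
  unfold OpenAUC
  field_simp
  linarith
end

section
/- In the empirical OSR setting, let M = max_{j∈U} ru j and let ε > 0. Define the masked close-set scores rk̃ by rk̃ i = rk i if h i = y i, and rk̃ i = M + ε if h i ≠ y i. Then OpenAUC(h, rk, ru) = AUC(rk̃, ru); i.e. OpenAUC equals the ordinary empirical AUC after assigning every misclassified close-set sample a score strictly above all open-set scores. -/
open Finset

/-- OpenAUC equals the ordinary empirical AUC after masking: every misclassified
close-set sample is assigned the score `M + ε`, strictly above all open-set scores,
where `M = max_{j ∈ U} ru j` and `ε > 0`. -/
theorem openAUC_eq_AUC_masked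
    {K U : Type*} [Fintype K] [Fintype U] [Nonempty K] [Nonempty U]
    (y h : K → ℕ) (rk : K → ℝ) (ru : U → ℝ) (ε : ℝ) (hε : 0 < ε) :
    OpenAUC y h rk ru =
      AUC (fun i => if h i = y i then rk i
            else (Finset.univ.sup' Finset.univ_nonempty ru) + ε) ru := by
  unfold OpenAUC AUC
  congr 1
  refine Finset.sum_congr rfl fun i _ => Finset.sum_congr rfl fun j _ => ?_
  by_cases hi : h i = y i
  · simp [hi]
  · have hj : ru j ≤ Finset.univ.sup' Finset.univ_nonempty ru :=
      Finset.le_sup' ru (Finset.mem_univ j)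
    have hn : ¬ (ru j > Finset.univ.sup' Finset.univ_nonempty ru + ε) := by
      intro hlt
      linarith
    simp only [if_neg hi, if_neg hn, zero_mul]
end
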